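/- Fix 0 < α < 1, 0 ≤ β < 1 and n ∈ ℕ. Let a_0, …, a_{n-1}, b_0, …, b_{n-1} ∈ ℂ and set g(x) = Σ_{j=0}^{n-1} ( a_j·(1-x)^j + b_j·(1-x)^{-α+j} ). If lim_{x→1⁻} [f, g]_n(x) = 0 for every f in the maximal domain D_max^{J,n}, then a_j = b_j = 0 for all j = 0, …, n-1. The analogous statement holds at the endpoint -1: if 0 < β < 1 and g(x) = Σ_{j=0}^{n-1} ( a_j·(1+x)^j + b_j·(1+x)^{-β+j} ) satisfies lim_{x→-1⁺} [f, g]_n(x) = 0 for every f ∈ D_max^{J,n}, then all a_j = b_j = 0. (This expresses that the 2n endpoint functions at each endpoint are linearly independent modulo the minimal domain.) -/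

import Mathlib

open MeasureTheory Set Filter Topology

/-- Membership in the weighted space `L²_{α,β}(-1,1)`. -/
def MemL2ab (α β : ℝ) (f : ℝ → ℂ) : Prop :=
  IntegrableOn (fun x : ℝ => ‖f x‖ ^ 2 * (1 - x) ^ α * (1 + x) ^ β) (Ioo (-1 : ℝ) 1)

/-- The Jacobi differential expression
`ℓ_{α,β}[f](x) = -(1-x)^{-α}(1+x)^{-β}·[(1-x)^{α+1}(1+x)^{β+1} f'(x)]'`. -/
noncomputable def jacobiL (α β : ℝ) (f : ℝ → ℂ) : ℝ → ℂ := fun x =>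
  -((((1 - x) ^ (-α) * (1 + x) ^ (-β) : ℝ) : ℂ) *
    deriv (fun y : ℝ => (((1 - y) ^ (α + 1) * (1 + y) ^ (β + 1) : ℝ) : ℂ) * deriv f y) x)

/-- The maximal domain `D_max^{J,n}` of the `n`-th power of the Jacobi expression:
`C^{2n}` functions on `(-1,1)` with `f ∈ L²_{α,β}` and `ℓ^n_{α,β}[f] ∈ L²_{α,β}`. -/
def JacobiMaxDom (α β : ℝ) (n : ℕ) (f : ℝ → ℂ) : Prop :=
  ContDiffOn ℝ (2 * n) f (Ioo (-1 : ℝ) 1) ∧ MemL2ab α β f ∧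
    MemL2ab α β ((jacobiL α β)^[n] f)

/-- The coefficient function `a_k(x) = (1-x)^{α+k}(1+x)^{β+k}`. -/
noncomputable def ak (α β : ℝ) (k : ℕ) (x : ℝ) : ℝ :=
  (1 - x) ^ (α + (k : ℝ)) * (1 + x) ^ (β + (k : ℝ))

/-- The `n`-th Jacobi sesquilinear form (for real-valued `g`; no conjugation):
`[f,g]_n(x) = Σ_{k=1}^{n} Σ_{j=1}^{k} (-1)^{k+j} { (a_k g^{(k)})^{(k-j)} f^{(j-1)}
 − (a_k f^{(k)})^{(k-j)} g^{(j-1)} }`. -/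
noncomputable def sesq (α β : ℝ) (n : ℕ) (f g : ℝ → ℂ) (x : ℝ) : ℂ :=
  ∑ k ∈ Finset.Icc 1 n, ∑ j ∈ Finset.Icc 1 k, (-1 : ℂ) ^ (k + j) *
    (iteratedDeriv (k - j) (fun y => ((ak α β k y : ℝ) : ℂ) * iteratedDeriv k g y) x *
        iteratedDeriv (j - 1) f x -
      iteratedDeriv (k - j) (fun y => ((ak α β k y : ℝ) : ℂ) * iteratedDeriv k f y) x *
        iteratedDeriv (j - 1) g x)

/-- The `n`-th Jacobi sesquilinear form with conjugation on the second argument. -/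
noncomputable def sesqC (α β : ℝ) (n : ℕ) (f g : ℝ → ℂ) (x : ℝ) : ℂ :=
  ∑ k ∈ Finset.Icc 1 n, ∑ j ∈ Finset.Icc 1 k, (-1 : ℂ) ^ (k + j) *
    (iteratedDeriv (k - j)
        (fun y => ((ak α β k y : ℝ) : ℂ) *
          iteratedDeriv k (fun z => (starRingEnd ℂ) (g z)) y) x *
        iteratedDeriv (j - 1) f x -
      iteratedDeriv (k - j) (fun y => ((ak α β k y : ℝ) : ℂ) * iteratedDeriv k f y) x *
        iteratedDeriv (j - 1) (fun z => (starRingEnd ℂ) (g z)) x)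

/-- `F` behaves like `c (1-x)^σ` near `1`, together with `N` derivatives. -/
def AsyN : ℕ → ℝ → ℂ → (ℝ → ℂ) → Prop
  | 0, σ, c, F => Tendsto (fun x : ℝ => (((1 - x) ^ (-σ) : ℝ) : ℂ) * F x) (𝓝[<] (1 : ℝ)) (𝓝 c)
  | N + 1, σ, c, F =>
    Tendsto (fun x : ℝ => (((1 - x) ^ (-σ) : ℝ) : ℂ) * F x) (𝓝[<] (1 : ℝ)) (𝓝 c) ∧
    (∀ x ∈ Ioo (-1 : ℝ) 1, DifferentiableAt ℝ F x) ∧ AsyN N (σ - 1) (-(σ : ℂ) * c) (deriv F)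

lemma ioo_mem_left : Ioo (-1 : ℝ) 1 ∈ 𝓝[<] (1 : ℝ) := Ioo_mem_nhdsLT (by norm_num)

lemma AsyN.tendsto {N : ℕ} {σ : ℝ} {c : ℂ} {F : ℝ → ℂ} (h : AsyN N σ c F) :
    Tendsto (fun x : ℝ => (((1 - x) ^ (-σ) : ℝ) : ℂ) * F x) (𝓝[<] (1 : ℝ)) (𝓝 c) := by
  cases N with
  | zero => exact h
  | succ N => exact h.1

lemma AsyN.pred {N : ℕ} {σ : ℝ} {c : ℂ} {F : ℝ → ℂ} (h : AsyN (N + 1) σ c F) : AsyN N σ c F := by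
  induction N generalizing σ c F with
  | zero => exact h.1
  | succ N ih => exact ⟨h.1, h.2.1, ih h.2.2⟩

lemma eventuallyEq_of_eqOn {F G : ℝ → ℂ} (hFG : ∀ x ∈ Ioo (-1 : ℝ) 1, F x = G x)
    {x : ℝ} (hx : x ∈ Ioo (-1 : ℝ) 1) : F =ᶠ[𝓝 x] G := by
  filter_upwards [isOpen_Ioo.mem_nhds hx] with y hy using hFG y hy

lemma AsyN.congr {N : ℕ} {σ : ℝ} {c : ℂ} {F G : ℝ → ℂ} (h : AsyN N σ c F)
    (hFG : ∀ x ∈ Ioo (-1 : ℝ) 1, F x = G x) : AsyN N σ c G := by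
  have key : ∀ {F G : ℝ → ℂ} {σ : ℝ} {c : ℂ}, (∀ x ∈ Ioo (-1 : ℝ) 1, F x = G x) →
      Tendsto (fun x : ℝ => (((1 - x) ^ (-σ) : ℝ) : ℂ) * F x) (𝓝[<] (1 : ℝ)) (𝓝 c) →
      Tendsto (fun x : ℝ => (((1 - x) ^ (-σ) : ℝ) : ℂ) * G x) (𝓝[<] (1 : ℝ)) (𝓝 c) := by
    intro F G σ c hFG h
    refine h.congr' ?_
    filter_upwards [ioo_mem_left] with x hx
    rw [hFG x hx]
  induction N generalizing σ c F G with
  | zero => exact key hFG h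
  | succ N ih =>
    refine ⟨key hFG h.1, fun x hx => ?_, ih h.2.2 fun x hx => ?_⟩
    · exact (eventuallyEq_of_eqOn hFG hx).differentiableAt_iff.1 (h.2.1 x hx)
    · exact (eventuallyEq_of_eqOn hFG hx).deriv_eq

lemma AsyN.add {N : ℕ} {σ : ℝ} {c d : ℂ} {F G : ℝ → ℂ} (hF : AsyN N σ c F) (hG : AsyN N σ d G) :
    AsyN N σ (c + d) (fun x => F x + G x) := by
  induction N generalizing σ c d F G with
  | zero => 
    refine (Tendsto.add hF hG).congr fun x => ?_
    ring
  | succ N ih =>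
    refine ⟨(hF.1.add hG.1).congr fun x => by ring, fun x hx => (hF.2.1 x hx).add (hG.2.1 x hx), ?_⟩
    rw [mul_add]
    refine (ih hF.2.2 hG.2.2).congr fun x hx => ?_
    exact (deriv_fun_add (hF.2.1 x hx) (hG.2.1 x hx)).symm

lemma AsyN.const_mul {N : ℕ} {σ : ℝ} {c : ℂ} (d : ℂ) {F : ℝ → ℂ} (hF : AsyN N σ c F) :
    AsyN N σ (d * c) (fun x => d * F x) := by
  induction N generalizing σ c F with
  | zero => 
    refine (Tendsto.const_mul d hF).congr fun x => ?_
    ring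
  | succ N ih =>
    refine ⟨(hF.1.const_mul d).congr fun x => by ring, fun x hx => (hF.2.1 x hx).const_mul d, ?_⟩
    rw [mul_left_comm]
    refine (ih hF.2.2).congr fun x hx => ?_
    exact (deriv_const_mul d (hF.2.1 x hx)).symm

lemma AsyN.zero (N : ℕ) (σ : ℝ) : AsyN N σ 0 (fun _ => 0) := by
  induction N generalizing σ with
  | zero => simp [AsyN]
  | succ N ih => simpa [AsyN] using ih _

lemma AsyN.sum {N : ℕ} {σ : ℝ} {ι : Type*} (s : Finset ι) {c : ι → ℂ} {F : ι → ℝ → ℂ}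
    (h : ∀ i ∈ s, AsyN N σ (c i) (F i)) : AsyN N σ (∑ i ∈ s, c i) (fun x => ∑ i ∈ s, F i x) := by
  classical
  induction s using Finset.induction_on with
  | empty => simpa using AsyN.zero N σ
  | insert i s hi ih =>
    simp only [Finset.sum_insert hi]
    exact (h i (by simp)).add (ih fun j hj => h j (by simp [hj]))

lemma AsyN.mul {N : ℕ} {σ τ : ℝ} {c d : ℂ} {F G : ℝ → ℂ} (hF : AsyN N σ c F) (hG : AsyN N τ d G) :
    AsyN N (σ + τ) (c * d) (fun x => F x * G x) := by
  have key : Tendsto (fun x : ℝ => (((1 - x) ^ (-(σ + τ)) : ℝ) : ℂ) * (F x * G x))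
      (𝓝[<] (1 : ℝ)) (𝓝 (c * d)) := by
    refine (hF.tendsto.mul hG.tendsto).congr' ?_
    filter_upwards [ioo_mem_left] with x hx
    have : (0 : ℝ) < 1 - x := by linarith [hx.2]
    rw [neg_add, Real.rpow_add this]
    push_cast
    ring
  induction N generalizing σ τ c d F G with
  | zero => exact key
  | succ N ih =>
    refine ⟨key, fun x hx => (hF.2.1 x hx).mul (hG.2.1 x hx), ?_⟩
    have key' : ∀ {σ τ : ℝ} {c d : ℂ} {F G : ℝ → ℂ}, AsyN N σ c F → AsyN N τ d G →
        Tendsto (fun x : ℝ => (((1 - x) ^ (-(σ + τ)) : ℝ) : ℂ) * (F x * G x))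
          (𝓝[<] (1 : ℝ)) (𝓝 (c * d)) := by
      intro σ τ c d F G hF hG
      refine (hF.tendsto.mul hG.tendsto).congr' ?_
      filter_upwards [ioo_mem_left] with x hx
      have : (0 : ℝ) < 1 - x := by linarith [hx.2]
      rw [neg_add, Real.rpow_add this]
      push_cast
      ring
    have h1 := ih hF.2.2 hG.pred (key' hF.2.2 hG.pred)
    have h2 := ih hF.pred hG.2.2 (key' hF.pred hG.2.2)
    rw [show σ - 1 + τ = σ + τ - 1 by ring] at h1
    rw [show σ + (τ - 1) = σ + τ - 1 by ring] at h2
    have h3 := (h1.add h2).congr (G := deriv fun x => F x * G x) fun x hx =>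
      (deriv_fun_mul (hF.2.1 x hx) (hG.2.1 x hx)).symm
    convert h3 using 1
    push_cast
    ring

lemma tendsto_one_sub_rpow {ε : ℝ} (hε : 0 < ε) :
    Tendsto (fun x : ℝ => (((1 - x) ^ ε : ℝ) : ℂ)) (𝓝[<] (1 : ℝ)) (𝓝 0) := by
  have : ContinuousAt (fun x : ℝ => (((1 - x) ^ ε : ℝ) : ℂ)) 1 := by
    have h1 : ContinuousAt (fun x : ℝ => (1 - x) ^ ε) 1 :=
      ContinuousAt.rpow_const (by fun_prop) (Or.inr hε.le)
    exact Complex.continuous_ofReal.continuousAt.comp h1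
  have h := this.tendsto
  simp only [sub_self, Real.zero_rpow hε.ne', Complex.ofReal_zero] at h
  exact h.mono_left nhdsWithin_le_nhds

lemma AsyN.shift {N : ℕ} {σ τ : ℝ} {c : ℂ} {F : ℝ → ℂ} (hF : AsyN N σ c F) (h : τ < σ) :
    AsyN N τ 0 F := by
  have key : Tendsto (fun x : ℝ => (((1 - x) ^ (-τ) : ℝ) : ℂ) * F x) (𝓝[<] (1 : ℝ)) (𝓝 0) := by
    have h1 := (tendsto_one_sub_rpow (sub_pos.2 h)).mul hF.tendsto
    rw [zero_mul] at h1
    refine h1.congr' ?_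
    filter_upwards [ioo_mem_left] with x hx
    have : (0 : ℝ) < 1 - x := by linarith [hx.2]
    rw [show -τ = (σ - τ) + -σ by ring, Real.rpow_add this]
    push_cast
    ring
  induction N generalizing σ τ c F with
  | zero => exact key
  | succ N ih =>
    refine ⟨key, hF.2.1, ?_⟩
    rw [mul_zero]
    refine ih hF.2.2 (by linarith) ?_
    have h1 := (tendsto_one_sub_rpow (sub_pos.2 h)).mul hF.2.2.tendsto
    rw [zero_mul] at h1
    refine h1.congr' ?_
    filter_upwards [ioo_mem_left] with x hx
    have : (0 : ℝ) < 1 - x := by linarith [hx.2]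
    rw [show -(τ - 1) = (σ - τ) + -(σ - 1) by ring, Real.rpow_add this]
    push_cast
    ring

lemma hasDerivAt_one_sub_rpow (σ : ℝ) {x : ℝ} (hx : x ∈ Ioo (-1 : ℝ) 1) :
    HasDerivAt (fun x : ℝ => (((1 - x) ^ σ : ℝ) : ℂ))
      (-(σ : ℂ) * (((1 - x) ^ (σ - 1) : ℝ) : ℂ)) x := by
  have h0 : (1 - x) ≠ 0 := by linarith [hx.2]
  have h1 : HasDerivAt (fun x : ℝ => 1 - x) (-1) x := by
    simpa using (hasDerivAt_id x).const_sub 1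
  have h2 := (h1.rpow_const (p := σ) (Or.inl h0)).ofReal_comp
  convert h2 using 1
  push_cast
  ring

lemma hasDerivAt_one_add_rpow (σ : ℝ) {x : ℝ} (hx : x ∈ Ioo (-1 : ℝ) 1) :
    HasDerivAt (fun x : ℝ => (((1 + x) ^ σ : ℝ) : ℂ))
      ((σ : ℂ) * (((1 + x) ^ (σ - 1) : ℝ) : ℂ)) x := by
  have h0 : (1 + x) ≠ 0 := by linarith [hx.1]
  have h1 : HasDerivAt (fun x : ℝ => 1 + x) 1 x := by
    simpa using (hasDerivAt_id x).const_add 1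
  have h2 := (h1.rpow_const (p := σ) (Or.inl h0)).ofReal_comp
  convert h2 using 1
  push_cast
  ring

lemma AsyN.one_sub_rpow (N : ℕ) (σ : ℝ) : AsyN N σ 1 (fun x : ℝ => (((1 - x) ^ σ : ℝ) : ℂ)) := by
  have key : ∀ σ : ℝ, Tendsto (fun x : ℝ => (((1 - x) ^ (-σ) : ℝ) : ℂ) * (((1 - x) ^ σ : ℝ) : ℂ))
      (𝓝[<] (1 : ℝ)) (𝓝 1) := by
    intro σ
    refine tendsto_const_nhds.congr' ?_
    filter_upwards [ioo_mem_left] with x hx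
    have : (0 : ℝ) < 1 - x := by linarith [hx.2]
    rw [← Complex.ofReal_mul, ← Real.rpow_add this]
    simp
  induction N generalizing σ with
  | zero => exact key σ
  | succ N ih =>
    refine ⟨key σ, fun x hx => (hasDerivAt_one_sub_rpow σ hx).differentiableAt, ?_⟩
    exact ((ih (σ - 1)).const_mul _).congr fun x hx => (hasDerivAt_one_sub_rpow σ hx).deriv.symm

lemma AsyN.one_add_rpow (N : ℕ) (σ : ℝ) :
    AsyN N 0 (((2 : ℝ) ^ σ : ℝ) : ℂ) (fun x : ℝ => (((1 + x) ^ σ : ℝ) : ℂ)) := by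
  have key : ∀ σ : ℝ, Tendsto (fun x : ℝ => (((1 - x) ^ (-(0 : ℝ)) : ℝ) : ℂ) *
      (((1 + x) ^ σ : ℝ) : ℂ)) (𝓝[<] (1 : ℝ)) (𝓝 (((2 : ℝ) ^ σ : ℝ) : ℂ)) := by
    intro σ
    have h1 : ContinuousAt (fun x : ℝ => (1 + x) ^ σ) 1 :=
      ContinuousAt.rpow_const (by fun_prop) (Or.inl (by norm_num))
    have h2 : Tendsto (fun x : ℝ => (((1 + x) ^ σ : ℝ) : ℂ)) (𝓝 1) (𝓝 _) :=
      (Complex.continuous_ofReal.continuousAt.comp h1).tendsto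
    norm_num at h2 ⊢
    exact h2.mono_left nhdsWithin_le_nhds
  induction N generalizing σ with
  | zero => exact key σ
  | succ N ih =>
    refine ⟨key σ, fun x hx => (hasDerivAt_one_add_rpow σ hx).differentiableAt, ?_⟩
    simp only [Complex.ofReal_zero, neg_zero, zero_mul]
    exact (((ih (σ - 1)).const_mul _).congr fun x hx =>
      (hasDerivAt_one_add_rpow σ hx).deriv.symm).shift (by norm_num)

/-- All orders. -/
def Asy (σ : ℝ) (c : ℂ) (F : ℝ → ℂ) : Prop := ∀ N, AsyN N σ c F

/-- The factor produced by `m` derivatives of `(1-x)^σ`. -/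
noncomputable def qf (σ : ℝ) (m : ℕ) : ℂ := ∏ i ∈ Finset.range m, ((i : ℂ) - (σ : ℂ))

lemma Asy.iteratedDeriv {σ : ℝ} {c : ℂ} {F : ℝ → ℂ} (h : Asy σ c F) (m : ℕ) :
    Asy (σ - m) (qf σ m * c) (iteratedDeriv m F) := by
  induction m with
  | zero => simpa [qf] using h
  | succ m ih =>
    intro N
    have h1 := (ih (N + 1)).2.2
    rw [iteratedDeriv_succ]
    convert h1 using 1
    · push_cast; ring
    · rw [qf, Finset.prod_range_succ, ← qf]; push_cast; ring

lemma Asy.mul {σ τ : ℝ} {c d : ℂ} {F G : ℝ → ℂ} (hF : Asy σ c F) (hG : Asy τ d G) :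
    Asy (σ + τ) (c * d) (fun x => F x * G x) := fun N => (hF N).mul (hG N)

lemma Asy.ak (α β : ℝ) (k : ℕ) :
    Asy (α + k) (((2 : ℝ) ^ (β + k) : ℝ) : ℂ) (fun y => ((ak α β k y : ℝ) : ℂ)) := by
  intro N
  have h := (AsyN.one_sub_rpow N (α + k)).mul (AsyN.one_add_rpow N (β + k))
  rw [add_zero, one_mul] at h
  exact h.congr fun x _ => by simp [_root_.ak]

lemma Asy.term {α β : ℝ} {f G : ℝ → ℂ} {r s : ℝ} {c d : ℂ} (hf : Asy r c f) (hG : Asy s d G)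
    {k j : ℕ} (hj : 1 ≤ j) (hjk : j ≤ k) :
    Asy (α + s + r + 1 - k)
      ((((2 : ℝ) ^ (β + k) : ℝ) : ℂ) * qf s k * qf (α + s) (k - j) * qf r (j - 1) * (c * d))
      (fun x => _root_.iteratedDeriv (k - j)
        (fun y => ((_root_.ak α β k y : ℝ) : ℂ) * _root_.iteratedDeriv k G y) x *
        _root_.iteratedDeriv (j - 1) f x) := by
  have h := (((Asy.ak α β k).mul (hG.iteratedDeriv k)).iteratedDeriv (k - j)).mul
    (hf.iteratedDeriv (j - 1))
  rw [Nat.cast_sub hjk, Nat.cast_sub hj, show α + k + (s - k) = α + s by ring] at h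
  convert h using 1
  · push_cast; ring
  · ring

/-- bilinear form -/
noncomputable def bil (α β : ℝ) (n : ℕ) (f G : ℝ → ℂ) (x : ℝ) : ℂ :=
  ∑ k ∈ Finset.Icc 1 n, ∑ j ∈ Finset.Icc 1 k, (-1 : ℂ) ^ (k + j) *
    (iteratedDeriv (k - j) (fun y => ((ak α β k y : ℝ) : ℂ) * iteratedDeriv k G y) x *
        iteratedDeriv (j - 1) f x -
      iteratedDeriv (k - j) (fun y => ((ak α β k y : ℝ) : ℂ) * iteratedDeriv k f y) x *
        iteratedDeriv (j - 1) G x)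

lemma Asy.tendsto_zero {c : ℂ} {F : ℝ → ℂ} (h : Asy 0 c F) : Tendsto F (𝓝[<] (1 : ℝ)) (𝓝 c) := by
  simpa [AsyN] using h 0

lemma bil_tendsto {α β : ℝ} {n : ℕ} (hn : 1 ≤ n) {f G : ℝ → ℂ} {r s : ℝ} {c d : ℂ}
    (hf : Asy r c f) (hG : Asy s d G) (hrs : α + s + r + 1 = n) :
    Tendsto (bil α β n f G) (𝓝[<] (1 : ℝ)) (𝓝 (∑ j ∈ Finset.Icc 1 n, (-1 : ℂ) ^ (n + j) *
      ((((2 : ℝ) ^ (β + n) : ℝ) : ℂ) * qf s n * qf (α + s) (n - j) * qf r (j - 1) * (c * d) -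
       (((2 : ℝ) ^ (β + n) : ℝ) : ℂ) * qf r n * qf (α + r) (n - j) * qf s (j - 1) * (d * c)))) := by
  have hL : ∀ k ∈ Finset.Icc 1 n, Tendsto (fun x => ∑ j ∈ Finset.Icc 1 k, (-1 : ℂ) ^ (k + j) *
    (iteratedDeriv (k - j) (fun y => ((ak α β k y : ℝ) : ℂ) * iteratedDeriv k G y) x *
        iteratedDeriv (j - 1) f x -
      iteratedDeriv (k - j) (fun y => ((ak α β k y : ℝ) : ℂ) * iteratedDeriv k f y) x *
        iteratedDeriv (j - 1) G x)) (𝓝[<] (1 : ℝ)) (𝓝 (if k = n then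
        (∑ j ∈ Finset.Icc 1 n, (-1 : ℂ) ^ (n + j) *
      ((((2 : ℝ) ^ (β + n) : ℝ) : ℂ) * qf s n * qf (α + s) (n - j) * qf r (j - 1) * (c * d) -
       (((2 : ℝ) ^ (β + n) : ℝ) : ℂ) * qf r n * qf (α + r) (n - j) * qf s (j - 1) * (d * c))) 
       else 0)) := by
    intro k hk
    have hkn := (Finset.mem_Icc.1 hk).2
    split_ifs with h
    · subst h
      refine tendsto_finsetSum _ fun j hj => ?_
      obtain ⟨hj1, hjk⟩ := Finset.mem_Icc.1 hj
      refine Tendsto.const_mul _ (Tendsto.sub ?_ ?_)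
      · have := hf.term (α := α) (β := β) hG hj1 hjk
        rw [hrs, sub_self] at this
        exact this.tendsto_zero
      · have := hG.term (α := α) (β := β) hf hj1 hjk
        rw [show α + r + s + 1 = α + s + r + 1 by ring, hrs, sub_self] at this
        exact this.tendsto_zero
    · have hlt : (k : ℝ) < n := by exact_mod_cast lt_of_le_of_ne hkn h
      rw [show (0 : ℂ) = ∑ j ∈ Finset.Icc 1 k, (-1 : ℂ) ^ (k + j) * (0 - 0) by simp]
      refine tendsto_finsetSum _ fun j hj => ?_
      obtain ⟨hj1, hjk⟩ := Finset.mem_Icc.1 hj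
      refine Tendsto.const_mul _ (Tendsto.sub ?_ ?_)
      · have := hf.term (α := α) (β := β) hG hj1 hjk
        exact Asy.tendsto_zero fun N => (this N).shift (by linarith)
      · have := hG.term (α := α) (β := β) hf hj1 hjk
        exact Asy.tendsto_zero fun N => (this N).shift (by linarith)
  have := tendsto_finsetSum _ hL
  rw [Finset.sum_ite_eq' (Finset.Icc 1 n) n, if_pos (Finset.mem_Icc.2 ⟨hn, le_rfl⟩)] at this
  exact this

lemma qf_nat_zero {p m : ℕ} (h : p < m) : qf (p : ℝ) m = 0 := by
  rw [qf]
  exact Finset.prod_eq_zero (Finset.mem_range.2 h) (by simp)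

lemma qf_ne_zero {σ : ℝ} {m : ℕ} (h : ∀ i < m, (i : ℝ) ≠ σ) : qf σ m ≠ 0 := by
  rw [qf, Finset.prod_ne_zero_iff]
  intro i hi h0
  exact h i (Finset.mem_range.1 hi) (by exact_mod_cast sub_eq_zero.1 h0)

lemma qf_nat_ne {p : ℕ} : qf (p : ℝ) p ≠ 0 :=
  qf_ne_zero fun i hi => by exact_mod_cast hi.ne

lemma qf_alpha_ne {α : ℝ} (h0 : 0 < α) (h1 : α < 1) (m n : ℕ) : qf (-α + m) n ≠ 0 := by
  refine qf_ne_zero fun i _ h => ?_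
  have h2 : (i : ℝ) < m := by linarith
  have h3 : (m : ℝ) < i + 1 := by linarith
  have h4 : i < m := by exact_mod_cast h2
  have h5 : m < i + 1 := by exact_mod_cast h3
  omega

lemma qf_sum_collapse {n m p : ℕ} (h : m + p + 1 = n) (w : ℂ) :
    ∑ j ∈ Finset.Icc 1 n, (-1 : ℂ) ^ (n + j) * (w * qf (m : ℝ) (n - j) * qf (p : ℝ) (j - 1)) =
      (-1 : ℂ) ^ (n + (p + 1)) * (w * qf (m : ℝ) m * qf (p : ℝ) p) := by
  rw [Finset.sum_eq_single (p + 1)]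
  · rw [show n - (p + 1) = m by omega, Nat.add_sub_cancel]
  · intro j hj hne
    rcases lt_or_gt_of_ne hne with h1 | h1
    · rw [qf_nat_zero (p := m) (m := n - j) (by omega)]; simp
    · rw [qf_nat_zero (p := p) (m := j - 1) (by omega)]; simp
  · intro hj
    exact absurd (Finset.mem_Icc.2 ⟨by omega, by omega⟩) hj

/-- Pairing against `(1-x)^p`. -/
lemma pair_poly {α β : ℝ} (h0 : 0 < α) (h1 : α < 1) {n m p : ℕ} (h : m + p + 1 = n)
    {f G : ℝ → ℂ} {d : ℂ} (hf : Asy p 1 f) (hG : Asy (-α + m) d G)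
    (ht : Tendsto (bil α β n f G) (𝓝[<] (1 : ℝ)) (𝓝 0)) : d = 0 := by
  have hr : α + (-α + m) + p + 1 = (n : ℝ) := by rw [← h]; push_cast; ring
  have := tendsto_nhds_unique ht (bil_tendsto (β := β) (by omega) hf hG hr)
  rw [qf_nat_zero (show p < n by omega), show α + (-α + m) = (m : ℝ) by ring] at this
  have h2 := qf_sum_collapse h ((((2 : ℝ) ^ (β + n) : ℝ) : ℂ) * qf (-α + m) n * d)
  have h3 : (-1 : ℂ) ^ (n + (p + 1)) * ((((2 : ℝ) ^ (β + n) : ℝ) : ℂ) * qf (-α + m) n * d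
      * qf (m : ℝ) m * qf (p : ℝ) p) = 0 := by
    rw [← h2, this]
    exact Finset.sum_congr rfl fun j _ => by ring
  have h4 : (((2 : ℝ) ^ (β + n) : ℝ) : ℂ) ≠ 0 := by
    exact_mod_cast (Real.rpow_pos_of_pos two_pos _).ne'
  simpa [h4, qf_nat_ne, qf_alpha_ne h0 h1] using h3

/-- Pairing against `(1-x)^{-α+p}`. -/
lemma pair_sing {α β : ℝ} (h0 : 0 < α) (h1 : α < 1) {n m p : ℕ} (h : m + p + 1 = n)
    {f G : ℝ → ℂ} {d : ℂ} (hf : Asy (-α + p) 1 f) (hG : Asy m d G)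
    (ht : Tendsto (bil α β n f G) (𝓝[<] (1 : ℝ)) (𝓝 0)) : d = 0 := by
  have hr : α + m + (-α + p) + 1 = (n : ℝ) := by rw [← h]; push_cast; ring
  have := tendsto_nhds_unique ht (bil_tendsto (β := β) (by omega) hf hG hr)
  rw [qf_nat_zero (show m < n by omega), show α + (-α + p) = (p : ℝ) by ring] at this
  have h2 := qf_sum_collapse (show p + m + 1 = n by omega)
    (-(((2 : ℝ) ^ (β + n) : ℝ) : ℂ) * qf (-α + p) n * d)
  have h3 : (-1 : ℂ) ^ (n + (m + 1)) * (-(((2 : ℝ) ^ (β + n) : ℝ) : ℂ) * qf (-α + p) n * d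
      * qf (p : ℝ) p * qf (m : ℝ) m) = 0 := by
    rw [← h2, this]
    exact Finset.sum_congr rfl fun j _ => by ring
  have h4 : (((2 : ℝ) ^ (β + n) : ℝ) : ℂ) ≠ 0 := by
    exact_mod_cast (Real.rpow_pos_of_pos two_pos _).ne'
  simpa [h4, qf_nat_ne, qf_alpha_ne h0 h1] using h3

lemma integrableOn_weight {a b : ℝ} (ha : -1 < a) (hb : 0 ≤ b) (φ : ℝ → ℝ) (hφ : Continuous φ) :
    IntegrableOn (fun x : ℝ => (1 - x) ^ a * ((1 + x) ^ b * φ x)) (Ioo (-1 : ℝ) 1) := by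
  have h1 : IntervalIntegrable (fun x : ℝ => x ^ a) volume 2 0 :=
    intervalIntegral.intervalIntegrable_rpow' ha
  have h2 := h1.comp_sub_left 1
  norm_num at h2
  have h3 : IntegrableOn (fun x : ℝ => (1 - x) ^ a) (Icc (-1 : ℝ) 1) := by
    rw [integrableOn_Icc_iff_integrableOn_Ioc]
    exact (intervalIntegrable_iff_integrableOn_Ioc_of_le (by norm_num)).1 h2
  refine (h3.mul_continuousOn (g' := fun x => (1 + x) ^ b * φ x) ?_ isCompact_Icc).mono_set
    Ioo_subset_Icc_self
  refine ContinuousOn.mul (ContinuousOn.rpow_const (by fun_prop) fun x _ => Or.inr hb)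
    hφ.continuousOn

open Polynomial in
lemma memL2ab_of_poly {α β σ : ℝ} (hσ : -1 < 2 * σ + α) (hβ : 0 ≤ β) {F : ℝ → ℂ} (Q : ℂ[X])
    (hF : ∀ x ∈ Ioo (-1 : ℝ) 1, F x = (((1 - x) ^ σ : ℝ) : ℂ) * Q.eval (x : ℂ)) :
    MemL2ab α β F := by
  have hφ : Continuous fun x : ℝ => ‖Q.eval (x : ℂ)‖ ^ 2 := by fun_prop
  refine (integrableOn_weight hσ hβ _ hφ).congr_fun (fun x hx => ?_) measurableSet_Ioo
  have : (0 : ℝ) < 1 - x := by linarith [hx.2]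
  simp only [hF x hx, norm_mul, Complex.norm_real, Real.norm_eq_abs, mul_pow, sq_abs]
  rw [Real.rpow_add this, two_mul, Real.rpow_add this]
  ring

open Polynomial in
lemma hasDerivAt_poly (Q : ℂ[X]) (x : ℝ) :
    HasDerivAt (fun x : ℝ => Q.eval (x : ℂ)) ((derivative Q).eval (x : ℂ)) x :=
  (Q.hasDerivAt (x : ℂ)).comp_ofReal

open Polynomial in
lemma jacobiL_poly {α β : ℝ} {F : ℝ → ℂ} (Q : ℂ[X])
    (hF : ∀ x ∈ Ioo (-1 : ℝ) 1, F x = Q.eval (x : ℂ)) :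
    ∃ R : ℂ[X], ∀ x ∈ Ioo (-1 : ℝ) 1, jacobiL α β F x = R.eval (x : ℂ) := by
  refine ⟨-(C (-((α : ℂ) + 1)) * (1 + X) * derivative Q + C ((β : ℂ) + 1) * (1 - X) * derivative Q
    + (1 - X) * (1 + X) * derivative (derivative Q)), fun x hx => ?_⟩
  have hd : ∀ y ∈ Ioo (-1 : ℝ) 1, deriv F y = (derivative Q).eval (y : ℂ) := fun y hy => by
    rw [(eventuallyEq_of_eqOn hF hy).deriv_eq, (hasDerivAt_poly Q y).deriv]
  have hp : (0 : ℝ) < 1 - x := by linarith [hx.2]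
  have hm : (0 : ℝ) < 1 + x := by linarith [hx.1]
  rw [jacobiL, (eventuallyEq_of_eqOn (G := fun y : ℝ => (((1 - y) ^ (α + 1) : ℝ) : ℂ) *
    (((1 + y) ^ (β + 1) : ℝ) : ℂ) * (derivative Q).eval (y : ℂ)) (fun y hy => by
      simp only [hd y hy]; push_cast; ring) hx).deriv_eq,
    (((hasDerivAt_one_sub_rpow (α + 1) hx).fun_mul (hasDerivAt_one_add_rpow (β + 1) hx)).fun_mul
      (hasDerivAt_poly _ x)).deriv]
  have e1 : (((1 - x) ^ (-α) : ℝ) : ℂ) * (((1 - x) ^ α : ℝ) : ℂ) = 1 := by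
    rw [← Complex.ofReal_mul, ← Real.rpow_add hp]; simp
  have e2 : (((1 + x) ^ (-β) : ℝ) : ℂ) * (((1 + x) ^ β : ℝ) : ℂ) = 1 := by
    rw [← Complex.ofReal_mul, ← Real.rpow_add hm]; simp
  rw [add_sub_cancel_right, add_sub_cancel_right, Real.rpow_add_one hp.ne',
    Real.rpow_add_one hm.ne']
  simp only [eval_neg, eval_add, eval_mul, eval_sub, eval_C, eval_X, eval_one]
  push_cast
  generalize (((1 - x) ^ (-α) : ℝ) : ℂ) = A at *
  generalize (((1 - x) ^ α : ℝ) : ℂ) = A' at *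
  generalize (((1 + x) ^ (-β) : ℝ) : ℂ) = B at *
  generalize (((1 + x) ^ β : ℝ) : ℂ) = B' at *
  generalize (derivative Q).eval (x : ℂ) = q at *
  generalize (derivative (derivative Q)).eval (x : ℂ) = q' at *
  linear_combination (-(B * B') * (-((α : ℂ) + 1) * (1 + x) * q + ((β : ℂ) + 1) * (1 - x) * q
    + (1 - x) * (1 + x) * q')) * e1 + (-(-((α : ℂ) + 1) * (1 + x) * q + ((β : ℂ) + 1) * (1 - x) * q
    + (1 - x) * (1 + x) * q')) * e2

open Polynomial in
lemma jacobiL_sing {α β : ℝ} {F : ℝ → ℂ} (Q : ℂ[X])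
    (hF : ∀ x ∈ Ioo (-1 : ℝ) 1, F x = (((1 - x) ^ (-α) : ℝ) : ℂ) * Q.eval (x : ℂ)) :
    ∃ R : ℂ[X], ∀ x ∈ Ioo (-1 : ℝ) 1,
      jacobiL α β F x = (((1 - x) ^ (-α) : ℝ) : ℂ) * R.eval (x : ℂ) := by
  set R : ℂ[X] := C (α : ℂ) * Q + (1 - X) * derivative Q with hR
  refine ⟨-(C ((β : ℂ) + 1) * R + (1 + X) * derivative R), fun x hx => ?_⟩
  have hd : ∀ y ∈ Ioo (-1 : ℝ) 1, (((1 - y) ^ (α + 1) * (1 + y) ^ (β + 1) : ℝ) : ℂ) * deriv F y =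
      (((1 + y) ^ (β + 1) : ℝ) : ℂ) * R.eval (y : ℂ) := fun y hy => by
    rw [(eventuallyEq_of_eqOn hF hy).deriv_eq,
      ((hasDerivAt_one_sub_rpow (-α) hy).fun_mul (hasDerivAt_poly Q y)).deriv]
    have hp : (0 : ℝ) < 1 - y := by linarith [hy.2]
    have e1 : (((1 - y) ^ (α + 1) : ℝ) : ℂ) * (((1 - y) ^ (-α - 1) : ℝ) : ℂ) = 1 := by
      rw [← Complex.ofReal_mul, ← Real.rpow_add hp]; simp
    have e2 : (((1 - y) ^ (α + 1) : ℝ) : ℂ) * (((1 - y) ^ (-α) : ℝ) : ℂ) = 1 - y := by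
      rw [← Complex.ofReal_mul, ← Real.rpow_add hp]; simp
    simp only [hR, eval_add, eval_mul, eval_sub, eval_C, eval_X, eval_one]
    push_cast
    generalize (((1 - y) ^ (α + 1) : ℝ) : ℂ) = A at *
    generalize (((1 - y) ^ (-α - 1) : ℝ) : ℂ) = A' at *
    generalize (((1 - y) ^ (-α) : ℝ) : ℂ) = Asg at *
    linear_combination ((((1 + y) ^ (β + 1) : ℝ) : ℂ) * α * Q.eval (y : ℂ)) * e1 +
      ((((1 + y) ^ (β + 1) : ℝ) : ℂ) * (derivative Q).eval (y : ℂ)) * e2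
  have hm : (0 : ℝ) < 1 + x := by linarith [hx.1]
  rw [jacobiL, (eventuallyEq_of_eqOn hd hx).deriv_eq,
    ((hasDerivAt_one_add_rpow (β + 1) hx).fun_mul (hasDerivAt_poly _ x)).deriv]
  have e2 : (((1 + x) ^ (-β) : ℝ) : ℂ) * (((1 + x) ^ β : ℝ) : ℂ) = 1 := by
    rw [← Complex.ofReal_mul, ← Real.rpow_add hm]; simp
  rw [add_sub_cancel_right, Real.rpow_add_one hm.ne']
  simp only [eval_neg, eval_add, eval_mul, eval_C, eval_X, eval_one]
  push_cast
  generalize (((1 - x) ^ (-α) : ℝ) : ℂ) = A at *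
  generalize (((1 + x) ^ (-β) : ℝ) : ℂ) = B at *
  generalize (((1 + x) ^ β : ℝ) : ℂ) = B' at *
  linear_combination (-A * (((β : ℂ) + 1) * R.eval (x : ℂ)
    + (1 + x) * (derivative R).eval (x : ℂ))) * e2

lemma contDiffOn_one_sub_rpow (σ : ℝ) (k : WithTop ℕ∞) :
    ContDiffOn ℝ k (fun x : ℝ => (((1 - x) ^ σ : ℝ) : ℂ)) (Ioo (-1 : ℝ) 1) := by
  refine Complex.ofRealCLM.contDiff.comp_contDiffOn (f := fun x : ℝ => (1 - x) ^ σ) ?_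
  refine ContDiffOn.rpow_const_of_ne (by fun_prop) fun x hx => ?_
  linarith [hx.2]

open Polynomial in
lemma maxDom_poly {α β : ℝ} (h0 : 0 < α) (hβ : 0 ≤ β) (n p : ℕ) :
    JacobiMaxDom α β n (fun x : ℝ => (((1 - x) ^ (p : ℝ) : ℝ) : ℂ)) := by
  have hit : ∀ n : ℕ, ∃ R : ℂ[X], ∀ x ∈ Ioo (-1 : ℝ) 1,
      (jacobiL α β)^[n] (fun x : ℝ => (((1 - x) ^ (p : ℝ) : ℝ) : ℂ)) x = R.eval (x : ℂ) := by
    intro n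
    induction n with
    | zero => exact ⟨(1 - X) ^ p, fun x hx => by simp⟩
    | succ n ih =>
      obtain ⟨Q, hQ⟩ := ih
      rw [Function.iterate_succ_apply']
      exact jacobiL_poly Q hQ
  obtain ⟨Q0, hQ0⟩ := hit 0
  obtain ⟨Q, hQ⟩ := hit n
  refine ⟨contDiffOn_one_sub_rpow _ _, memL2ab_of_poly (σ := 0) (by linarith) hβ Q0 fun x hx => ?_,
    memL2ab_of_poly (σ := 0) (by linarith) hβ Q fun x hx => ?_⟩
  · simpa using hQ0 x hx
  · simpa using hQ x hx

open Polynomial in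
lemma maxDom_sing {α β : ℝ} (h1 : α < 1) (hβ : 0 ≤ β) (n p : ℕ) :
    JacobiMaxDom α β n (fun x : ℝ => (((1 - x) ^ (-α + (p : ℝ)) : ℝ) : ℂ)) := by
  have hit : ∀ n : ℕ, ∃ R : ℂ[X], ∀ x ∈ Ioo (-1 : ℝ) 1,
      (jacobiL α β)^[n] (fun x : ℝ => (((1 - x) ^ (-α + (p : ℝ)) : ℝ) : ℂ)) x =
        (((1 - x) ^ (-α) : ℝ) : ℂ) * R.eval (x : ℂ) := by
    intro n
    induction n with
    | zero =>
      refine ⟨(1 - X) ^ p, fun x hx => ?_⟩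
      have : (0 : ℝ) < 1 - x := by linarith [hx.2]
      simp [Real.rpow_add this]
    | succ n ih =>
      obtain ⟨Q, hQ⟩ := ih
      rw [Function.iterate_succ_apply']
      exact jacobiL_sing Q hQ
  obtain ⟨Q0, hQ0⟩ := hit 0
  obtain ⟨Q, hQ⟩ := hit n
  exact ⟨contDiffOn_one_sub_rpow _ _, memL2ab_of_poly (by linarith) hβ Q0 hQ0,
    memL2ab_of_poly (by linarith) hβ Q hQ⟩

lemma endpoint_one {α β : ℝ} (hα0 : 0 < α) (hα1 : α < 1) (hβ0 : 0 ≤ β) (n : ℕ)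
    (a b : ℕ → ℂ) (H : ∀ f : ℝ → ℂ, JacobiMaxDom α β n f →
        Tendsto (sesqC α β n f (fun x : ℝ => ∑ j ∈ Finset.range n,
            (a j * (((1 - x) ^ j : ℝ) : ℂ) + b j * (((1 - x) ^ (-α + (j : ℝ)) : ℝ) : ℂ))))
          (𝓝[<] (1 : ℝ)) (𝓝 0)) :
      ∀ j < n, a j = 0 ∧ b j = 0 := by
  set G : ℝ → ℂ := fun z => (starRingEnd ℂ) (∑ j ∈ Finset.range n,
    (a j * (((1 - z) ^ j : ℝ) : ℂ) + b j * (((1 - z) ^ (-α + (j : ℝ)) : ℝ) : ℂ))) with hG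
  have H' : ∀ f : ℝ → ℂ, JacobiMaxDom α β n f →
      Tendsto (bil α β n f G) (𝓝[<] (1 : ℝ)) (𝓝 0) := H
  have hGx : ∀ x, (∑ j ∈ Finset.range n, ((starRingEnd ℂ) (a j) * (((1 - x) ^ (j : ℝ) : ℝ) : ℂ) +
      (starRingEnd ℂ) (b j) * (((1 - x) ^ (-α + (j : ℝ)) : ℝ) : ℂ))) = G x := by
    intro x
    simp [hG, -Complex.ofReal_sub]
  intro m
  induction m using Nat.strong_induction_on with
  | _ m ih =>
  intro hm
  have hlow : ∀ j < m, a j = 0 ∧ b j = 0 := fun j hj => ih j hj (hj.trans hm)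
  have hsplit : m + (n - 1 - m) + 1 = n := by omega
  have hb : b m = 0 := by
    have hA : Asy (-α + m) ((starRingEnd ℂ) (b m)) G := by
      intro N
      have h1 : ∀ j ∈ Finset.range n, AsyN N (-α + m) (if j = m then (starRingEnd ℂ) (b m) else 0)
          (fun x => (starRingEnd ℂ) (a j) * (((1 - x) ^ (j : ℝ) : ℝ) : ℂ) +
            (starRingEnd ℂ) (b j) * (((1 - x) ^ (-α + (j : ℝ)) : ℝ) : ℂ)) := by
        intro j _
        have ha' := (AsyN.one_sub_rpow N (j : ℝ)).const_mul ((starRingEnd ℂ) (a j))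
        have hb' := (AsyN.one_sub_rpow N (-α + (j : ℝ))).const_mul ((starRingEnd ℂ) (b j))
        rcases lt_trichotomy j m with h | h | h
        · rw [if_neg h.ne, (hlow j h).1, (hlow j h).2]
          simpa using AsyN.zero N (-α + m)
        · subst h
          simpa using (ha'.shift (show -α + (j : ℝ) < j by linarith)).add hb'
        · rw [if_neg h.ne']
          have h' : (m : ℝ) < j := by exact_mod_cast h
          simpa using (ha'.shift (show -α + (m : ℝ) < j by linarith)).add
            (hb'.shift (show -α + (m : ℝ) < -α + j by linarith))
      have h2 := AsyN.sum _ h1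
      rw [Finset.sum_ite_eq' _ m, if_pos (Finset.mem_range.2 hm)] at h2
      exact h2.congr fun x _ => hGx x
    have := pair_poly hα0 hα1 hsplit (fun N => AsyN.one_sub_rpow N _) hA
      (H' _ (maxDom_poly hα0 hβ0 n _))
    simpa using this
  have ha : a m = 0 := by
    have hA : Asy m ((starRingEnd ℂ) (a m)) G := by
      intro N
      have h1 : ∀ j ∈ Finset.range n, AsyN N m (if j = m then (starRingEnd ℂ) (a m) else 0)
          (fun x => (starRingEnd ℂ) (a j) * (((1 - x) ^ (j : ℝ) : ℝ) : ℂ) +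
            (starRingEnd ℂ) (b j) * (((1 - x) ^ (-α + (j : ℝ)) : ℝ) : ℂ)) := by
        intro j _
        have ha' := (AsyN.one_sub_rpow N (j : ℝ)).const_mul ((starRingEnd ℂ) (a j))
        have hb' := (AsyN.one_sub_rpow N (-α + (j : ℝ))).const_mul ((starRingEnd ℂ) (b j))
        rcases lt_trichotomy j m with h | h | h
        · rw [if_neg h.ne, (hlow j h).1, (hlow j h).2]
          simpa using AsyN.zero N m
        · subst h
          simpa [hb] using ha'
        · rw [if_neg h.ne']
          have h' : (m : ℝ) + 1 ≤ j := by exact_mod_cast h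
          simpa using (ha'.shift (show (m : ℝ) < j by linarith)).add
            (hb'.shift (show (m : ℝ) < -α + j by linarith))
      have h2 := AsyN.sum _ h1
      rw [Finset.sum_ite_eq' _ m, if_pos (Finset.mem_range.2 hm)] at h2
      exact h2.congr fun x _ => hGx x
    have := pair_sing hα0 hα1 hsplit (fun N => AsyN.one_sub_rpow N _) hA
      (H' _ (maxDom_sing hα1 hβ0 n _))
    simpa using this
  exact ⟨ha, hb⟩

lemma jacobiL_neg (α β : ℝ) (f : ℝ → ℂ) :
    jacobiL β α (fun x => f (-x)) = fun x => jacobiL α β f (-x) := by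
  funext x
  have h1 : (fun y : ℝ => (((1 - y) ^ (β + 1) * (1 + y) ^ (α + 1) : ℝ) : ℂ) *
      deriv (fun x => f (-x)) y) = fun y => (fun z : ℝ =>
        -((((1 - z) ^ (α + 1) * (1 + z) ^ (β + 1) : ℝ) : ℂ) * deriv f z)) (-y) := by
    funext y
    rw [deriv_comp_neg]
    simp only [sub_neg_eq_add, ← sub_eq_add_neg]
    push_cast
    ring
  simp only [jacobiL]
  rw [h1, deriv_comp_neg (f := fun z : ℝ =>
    -((((1 - z) ^ (α + 1) * (1 + z) ^ (β + 1) : ℝ) : ℂ) * deriv f z)), deriv.fun_neg, sub_neg_eq_add, ← sub_eq_add_neg]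
  push_cast
  ring

lemma jacobiL_iter_neg (α β : ℝ) (n : ℕ) (f : ℝ → ℂ) :
    (jacobiL β α)^[n] (fun x => f (-x)) = fun x => (jacobiL α β)^[n] f (-x) := by
  induction n with
  | zero => rfl
  | succ n ih => rw [Function.iterate_succ_apply', Function.iterate_succ_apply', ih, jacobiL_neg]

lemma memL2ab_neg {α β : ℝ} {f : ℝ → ℂ} (h : MemL2ab α β f) : MemL2ab β α (fun x => f (-x)) := by
  have h1 := IntegrableOn.comp_neg h
  simp only [neg_Ioo, neg_neg, sub_neg_eq_add, ← sub_eq_add_neg] at h1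
  refine h1.congr_fun (fun x _ => ?_) measurableSet_Ioo
  simp only
  ring

lemma maxDom_neg {α β : ℝ} {n : ℕ} {f : ℝ → ℂ} (h : JacobiMaxDom α β n f) :
    JacobiMaxDom β α n (fun x => f (-x)) := by
  refine ⟨?_, memL2ab_neg h.2.1, ?_⟩
  · refine h.1.comp (contDiff_neg.contDiffOn) fun x hx => ?_
    exact ⟨by linarith [hx.2], by linarith [hx.1]⟩
  · rw [jacobiL_iter_neg]
    exact memL2ab_neg h.2.2

lemma ak_iter_neg (α β : ℝ) (m k : ℕ) (g : ℝ → ℂ) (x : ℝ) :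
    iteratedDeriv m (fun y => ((ak β α k y : ℝ) : ℂ) * iteratedDeriv k (fun x => g (-x)) y) x =
     (-1) ^ (m + k) * iteratedDeriv m (fun y => ((ak α β k y : ℝ) : ℂ) * iteratedDeriv k g y) (-x) := by
  have h1 : (fun y => ((ak β α k y : ℝ) : ℂ) * iteratedDeriv k (fun x => g (-x)) y) =
      fun y => (-1) ^ k * (fun z => ((ak α β k z : ℝ) : ℂ) * iteratedDeriv k g z) (-y) := by
    funext y
    rw [iteratedDeriv_comp_neg]
    simp only [ak, sub_neg_eq_add, ← sub_eq_add_neg, Complex.real_smul]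
    push_cast
    ring
  rw [h1, iteratedDeriv_const_mul_field, iteratedDeriv_comp_neg (f := fun z =>
    ((ak α β k z : ℝ) : ℂ) * iteratedDeriv k g z), Complex.real_smul]
  push_cast
  ring

lemma bil_neg (α β : ℝ) (n : ℕ) (f g : ℝ → ℂ) (x : ℝ) :
    bil β α n (fun x => f (-x)) (fun x => g (-x)) x = -bil α β n f g (-x) := by
  simp only [bil, ← Finset.sum_neg_distrib]
  refine Finset.sum_congr rfl fun k hk => Finset.sum_congr rfl fun j hj => ?_
  obtain ⟨hj1, hjk⟩ := Finset.mem_Icc.1 hj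
  rw [ak_iter_neg α β, ak_iter_neg α β, iteratedDeriv_comp_neg, iteratedDeriv_comp_neg]
  simp only [Complex.real_smul]
  push_cast
  have : (-1 : ℂ) ^ (k - j + k) * (-1) ^ (j - 1) = -1 := by
    rw [← pow_add]
    exact Odd.neg_one_pow ⟨k - 1, by omega⟩
  generalize (-1 : ℂ) ^ (k - j + k) = A at *
  generalize (-1 : ℂ) ^ (j - 1) = B at *
  generalize iteratedDeriv (k - j) (fun y => ((ak α β k y : ℝ) : ℂ) * iteratedDeriv k g y) (-x) = U
  generalize iteratedDeriv (k - j) (fun y => ((ak α β k y : ℝ) : ℂ) * iteratedDeriv k f y) (-x) = V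
  linear_combination ((-1 : ℂ) ^ (k + j) * (U * iteratedDeriv (j - 1) f (-x)
    - V * iteratedDeriv (j - 1) g (-x))) * this

/-- Linear independence modulo the minimal domain of the `2n` endpoint functions
`(1-x)^j`, `(1-x)^{-α+j}` at `1` (for `0 < α`), and of `(1+x)^j`, `(1+x)^{-β+j}` at `-1`
(for `0 < β`): if a linear combination pairs to zero against every element of the maximal
domain in the sesquilinear form at the endpoint, then all coefficients vanish. -/
theorem jacobi_endpoint_functions_linearly_independent (α β : ℝ)
    (hα0 : 0 < α) (hα1 : α < 1) (hβ0 : 0 ≤ β) (hβ1 : β < 1) (n : ℕ) (hn : 1 ≤ n)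
    (a b : ℕ → ℂ) :
    ((∀ f : ℝ → ℂ, JacobiMaxDom α β n f →
        Tendsto (sesqC α β n f (fun x : ℝ => ∑ j ∈ Finset.range n,
            (a j * (((1 - x) ^ j : ℝ) : ℂ) + b j * (((1 - x) ^ (-α + (j : ℝ)) : ℝ) : ℂ))))
          (𝓝[<] (1 : ℝ)) (𝓝 0)) →
      ∀ j < n, a j = 0 ∧ b j = 0) ∧
    (0 < β →
      (∀ f : ℝ → ℂ, JacobiMaxDom α β n f →
        Tendsto (sesqC α β n f (fun x : ℝ => ∑ j ∈ Finset.range n,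
            (a j * (((1 + x) ^ j : ℝ) : ℂ) + b j * (((1 + x) ^ (-β + (j : ℝ)) : ℝ) : ℂ))))
          (𝓝[>] (-1 : ℝ)) (𝓝 0)) →
      ∀ j < n, a j = 0 ∧ b j = 0) := by
  refine ⟨endpoint_one hα0 hα1 hβ0 n a b, fun hβ H => ?_⟩
  refine endpoint_one hβ hβ1 hα0.le n a b fun f hf => ?_
  have h1 := H _ (maxDom_neg hf)
  have h2 : Tendsto (fun x : ℝ => -x) (𝓝[<] (1 : ℝ)) (𝓝[>] (-1 : ℝ)) := tendsto_neg_nhdsLT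
  have h3 := (h1.comp h2).neg
  rw [neg_zero] at h3
  refine h3.congr fun x => ?_
  have h4 := bil_neg β α n f (fun x : ℝ => (starRingEnd ℂ) (∑ j ∈ Finset.range n,
    (a j * (((1 - x) ^ j : ℝ) : ℂ) + b j * (((1 - x) ^ (-β + (j : ℝ)) : ℝ) : ℂ)))) (-x)
  simp only [neg_neg, sub_neg_eq_add] at h4
  exact neg_eq_iff_eq_neg.2 h4
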